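/- For every integer j ≥ 1 and every integer d ≥ 1, there exists a constant C = C(d, j) > 0 such that for every integer n ≥ 3 and every connected simple graph G on n vertices with maximum degree at most d, the multiplicity of the j-th largest eigenvalue of the adjacency matrix of G is at most C·n / log log n. Here, if λ₁ ≥ λ₂ ≥ … ≥ λ_n denote the eigenvalues of the (real symmetric) adjacency matrix of G listed in decreasing order with multiplicity, the multiplicity of the j-th eigenvalue is the number of indices i with λ_i = λ_j. -/

import Mathlib

open Polynomial

namespace SimpleGraph

section Distance

variable {V : Type*} {G : SimpleGraph V}

lemma Connected.dist_le_succ_of_adj (hG : G.Connected) {v u w : V} (h : G.Adj u w) :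
    G.dist v w ≤ G.dist v u + 1 := by
  have := hG.dist_triangle (u := v) (v := u) (w := w)
  rwa [dist_eq_one_iff_adj.2 h] at this

lemma Connected.exists_adj_dist_lt (hG : G.Connected) {v w : V} (h : v ≠ w) :
    ∃ u, G.Adj u w ∧ G.dist v u < G.dist v w := by
  obtain ⟨p, hp⟩ := hG.exists_walk_length_eq_dist w v
  rw [dist_comm] at hp
  cases p with
  | nil => exact absurd rfl h
  | cons h' q =>
    refine ⟨_, h'.symm, ?_⟩
    rw [dist_comm]
    have := dist_le q
    simp only [Walk.length_cons] at hp
    omega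

variable [Fintype V]

/-- The set of vertices at distance at most `r` from `v`. -/
noncomputable def distBall (G : SimpleGraph V) (v : V) (r : ℕ) : Finset V :=
  Finset.univ.filter fun w => G.dist v w ≤ r

@[simp]
lemma mem_distBall {v w : V} {r : ℕ} : w ∈ G.distBall v r ↔ G.dist v w ≤ r := by
  simp [distBall]

lemma Connected.card_distBall_le [DecidableRel G.Adj] (hG : G.Connected) {d : ℕ}
    (hd : ∀ v, G.degree v ≤ d) (v : V) (r : ℕ) : (G.distBall v r).card ≤ (d + 1) ^ r := by
  classical
  induction r with
  | zero =>
    have : G.distBall v 0 ⊆ {v} := by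
      intro w hw
      simp only [mem_distBall, Nat.le_zero, hG.dist_eq_zero_iff] at hw
      simp [hw]
    simpa using Finset.card_le_card this
  | succ r ih =>
    have hsub : G.distBall v (r + 1) ⊆
        (G.distBall v r).biUnion fun u => insert u (G.neighborFinset u) := by
      intro w hw
      rw [mem_distBall] at hw
      simp only [Finset.mem_biUnion, mem_distBall, Finset.mem_insert, mem_neighborFinset]
      by_cases h : v = w
      · subst h
        exact ⟨v, by simp, Or.inl rfl⟩
      · obtain ⟨u, hu, hlt⟩ := hG.exists_adj_dist_lt h
        exact ⟨u, by omega, Or.inr hu⟩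
    calc (G.distBall v (r + 1)).card
        ≤ _ := Finset.card_le_card hsub
      _ ≤ (G.distBall v r).card * (d + 1) := by
        refine Finset.card_biUnion_le_card_mul _ _ _ fun u _ => ?_
        refine (Finset.card_insert_le _ _).trans ?_
        simpa using hd u
      _ ≤ (d + 1) ^ (r + 1) := by
        rw [pow_succ]
        exact Nat.mul_le_mul_right _ ih

lemma Connected.lt_card_distBall (hG : G.Connected) (v : V) {s : ℕ}
    (hs : s < Fintype.card V) : s < (G.distBall v s).card := by
  classical
  induction s with
  | zero => exact Finset.card_pos.2 ⟨v, by simp⟩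
  | succ s ih =>
    have ih := ih (by omega)
    have hsub : G.distBall v s ⊆ G.distBall v (s + 1) := fun w hw => by
      rw [mem_distBall] at hw ⊢
      omega
    by_cases huniv : G.distBall v s = Finset.univ
    · rw [huniv, Finset.univ_subset_iff] at hsub
      rwa [hsub, Finset.card_univ]
    · obtain ⟨x, hx⟩ : ∃ x, x ∉ G.distBall v s := by
        by_contra! h
        exact huniv (Finset.eq_univ_iff_forall.2 h)
      obtain ⟨p⟩ := hG.preconnected v x
      obtain ⟨e, -, he1, he2⟩ := p.exists_boundary_dart (G.distBall v s : Set V)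
        (by simp) (by simpa using hx)
      rw [Finset.mem_coe] at he1 he2
      have hmem : e.snd ∈ G.distBall v (s + 1) := by
        rw [mem_distBall] at he1 ⊢
        have := hG.dist_le_succ_of_adj (v := v) e.adj
        omega
      have : (G.distBall v s).card < (G.distBall v (s + 1)).card :=
        Finset.card_lt_card (Finset.ssubset_iff_subset_ne.2 ⟨hsub, fun h => he2 (h ▸ hmem)⟩)
      omega

lemma exists_separated_cover (G : SimpleGraph V) (U : Finset V) (t : ℕ) :
    ∃ W ⊆ U, (∀ u ∈ W, ∀ w ∈ W, u ≠ w → t < G.dist u w) ∧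
      ∀ u ∈ U, ∃ w ∈ W, G.dist w u ≤ t := by
  classical
  let P : Finset (Finset V) :=
    U.powerset.filter fun W => ∀ u ∈ W, ∀ w ∈ W, u ≠ w → t < G.dist u w
  obtain ⟨W, hW, hmax⟩ := P.exists_max_image Finset.card ⟨∅, by simp [P]⟩
  simp only [P, Finset.mem_filter, Finset.mem_powerset] at hW hmax
  refine ⟨W, hW.1, hW.2, fun u hu => ?_⟩
  by_contra! hcon
  have huW : u ∉ W := fun h => by simpa using hcon u h
  have := hmax (insert u W) ⟨Finset.insert_subset hu hW.1, by
    intro a ha b hb hab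
    rw [Finset.mem_insert] at ha hb
    rcases ha with rfl | ha <;> rcases hb with rfl | hb
    · exact absurd rfl hab
    · rw [dist_comm]; exact hcon b hb
    · exact hcon a ha
    · exact hW.2 a ha b hb hab⟩
  rw [Finset.card_insert_of_notMem huW] at this
  omega

lemma Connected.exists_net (hG : G.Connected) {s : ℕ} (hs : s < Fintype.card V) :
    ∃ Z : Finset V, Z.card * (s + 1) ≤ Fintype.card V ∧ ∀ v, ∃ z ∈ Z, G.dist z v ≤ 2 * s := by
  classical
  obtain ⟨Z, -, hsep, hcov⟩ := G.exists_separated_cover Finset.univ (2 * s)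
  refine ⟨Z, ?_, fun v => hcov v (Finset.mem_univ v)⟩
  rw [← smul_eq_mul]
  calc Z.card • (s + 1) ≤ ∑ z ∈ Z, (G.distBall z s).card :=
        Finset.card_nsmul_le_sum _ _ _ fun z _ => hG.lt_card_distBall z hs
    _ = (Z.biUnion fun z => G.distBall z s).card := by
        refine (Finset.card_biUnion fun a ha b hb hab => ?_).symm
        rw [Function.onFun, Finset.disjoint_left]
        intro x hxa hxb
        rw [mem_distBall] at hxa hxb
        have h1 := hsep a ha b hb hab
        have h2 := hG.dist_triangle (u := a) (v := x) (w := b)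
        rw [dist_comm (u := x)] at h2
        omega
    _ ≤ Fintype.card V := Finset.card_le_univ _

end Distance
end SimpleGraph

namespace Matrix

variable {V : Type*} [Fintype V] {A : Matrix V V ℝ}

lemma IsSymm.dotProduct_mulVec_comm (hA : A.IsSymm) (x y : V → ℝ) :
    x ⬝ᵥ A *ᵥ y = (A *ᵥ x) ⬝ᵥ y := by
  rw [dotProduct_mulVec, ← mulVec_transpose, hA.eq]

lemma IsSymm.mulVec_dotProduct_mulVec_pow [DecidableEq V] (hA : A.IsSymm) (x : V → ℝ) (r : ℕ) :
    (A ^ r *ᵥ x) ⬝ᵥ (A ^ r *ᵥ x) = x ⬝ᵥ A ^ (2 * r) *ᵥ x := by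
  rw [← (hA.pow r).dotProduct_mulVec_comm, mulVec_mulVec, ← pow_add, two_mul]

lemma neg_dotProduct_mulVec_le_of_nonneg (hnn : ∀ u w, 0 ≤ A u w) {D : Set V} {c : ℝ}
    (hD : ∀ x : V → ℝ, (∀ u ∉ D, x u = 0) → x ⬝ᵥ A *ᵥ x ≤ c * (x ⬝ᵥ x))
    {x : V → ℝ} (hx : ∀ u ∉ D, x u = 0) : -(x ⬝ᵥ A *ᵥ x) ≤ c * (x ⬝ᵥ x) := by
  have h1 := hD (fun u => |x u|) (fun u hu => by simp [hx u hu])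
  have h2 : (fun u => |x u|) ⬝ᵥ (fun u => |x u|) = x ⬝ᵥ x := by
    simp [dotProduct]
  rw [h2] at h1
  refine le_trans ?_ h1
  simp only [dotProduct, mulVec, Finset.mul_sum, ← Finset.sum_neg_distrib]
  refine Finset.sum_le_sum fun u _ => Finset.sum_le_sum fun w _ => ?_
  calc -(x u * (A u w * x w)) ≤ |x u * (A u w * x w)| := neg_le_abs _
    _ = |x u| * (A u w * |x w|) := by rw [abs_mul, abs_mul, abs_of_nonneg (hnn u w)]

/-- If the quadratic form of a symmetric nonnegative matrix is at most `c` on the unit vectors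
supported on `D`, then the matrix expands vectors of `D` mapped into `D` by a factor at most `c`. -/
lemma IsSymm.mulVec_dotProduct_self_le (hA : A.IsSymm) (hnn : ∀ u w, 0 ≤ A u w) {D : Set V}
    {c : ℝ} (hc : 0 < c)
    (hD : ∀ x : V → ℝ, (∀ u ∉ D, x u = 0) → x ⬝ᵥ A *ᵥ x ≤ c * (x ⬝ᵥ x))
    {y : V → ℝ} (hy : ∀ u ∉ D, y u = 0) (hAy : ∀ u ∉ D, (A *ᵥ y) u = 0) :
    (A *ᵥ y) ⬝ᵥ (A *ᵥ y) ≤ c ^ 2 * (y ⬝ᵥ y) := by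
  have h1 := hD (c • y + A *ᵥ y) (fun u hu => by simp [hy u hu, hAy u hu])
  have h2 := neg_dotProduct_mulVec_le_of_nonneg hnn hD (x := c • y - A *ᵥ y)
    (fun u hu => by simp [hy u hu, hAy u hu])
  have h3 : y ⬝ᵥ A *ᵥ (A *ᵥ y) = (A *ᵥ y) ⬝ᵥ (A *ᵥ y) := hA.dotProduct_mulVec_comm _ _
  have h4 : (A *ᵥ y) ⬝ᵥ y = y ⬝ᵥ (A *ᵥ y) := dotProduct_comm _ _
  simp only [mulVec_add, mulVec_sub, mulVec_smul, add_dotProduct, sub_dotProduct, dotProduct_add,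
    dotProduct_sub, smul_dotProduct, dotProduct_smul, smul_eq_mul, h3, h4] at h1 h2
  have h5 : 0 ≤ 2 * c * (c ^ 2 * (y ⬝ᵥ y) - (A *ᵥ y) ⬝ᵥ (A *ᵥ y)) := by nlinarith
  have := nonneg_of_mul_nonneg_right h5 (by positivity)
  linarith

variable [DecidableEq V]

/-- The matrix `A` with all rows and columns outside `T` replaced by zero. -/
def zeroOutside (A : Matrix V V ℝ) (T : Finset V) : Matrix V V ℝ :=
  of fun u w => if u ∈ T ∧ w ∈ T then A u w else 0

omit [Fintype V] in
lemma zeroOutside_apply (A : Matrix V V ℝ) (T : Finset V) (u w : V) :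
    A.zeroOutside T u w = if u ∈ T ∧ w ∈ T then A u w else 0 := rfl

omit [Fintype V] in
lemma IsSymm.zeroOutside (hA : A.IsSymm) (T : Finset V) : (A.zeroOutside T).IsSymm := by
  ext u w
  simp only [transpose_apply, zeroOutside_apply, hA.apply u w, and_comm]

omit [Fintype V] in
lemma zeroOutside_nonneg (hnn : ∀ u w, 0 ≤ A u w) (T : Finset V) (u w : V) :
    0 ≤ A.zeroOutside T u w := by
  rw [zeroOutside_apply]
  split_ifs
  exacts [hnn u w, le_rfl]

omit [Fintype V] in
lemma zeroOutside_le (hnn : ∀ u w, 0 ≤ A u w) (T : Finset V) (u w : V) :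
    A.zeroOutside T u w ≤ A u w := by
  rw [zeroOutside_apply]
  split_ifs
  exacts [le_rfl, hnn u w]

lemma zeroOutside_mulVec_of_notMem (T : Finset V) (x : V → ℝ) {u : V} (hu : u ∉ T) :
    (A.zeroOutside T *ᵥ x) u = 0 := by
  simp [mulVec, dotProduct, zeroOutside_apply, hu]

lemma zeroOutside_mulVec_of_eigenvector {T : Finset V} {x : V → ℝ} {c : ℝ}
    (hx : A *ᵥ x = c • x) (hT : ∀ u ∉ T, x u = 0) : A.zeroOutside T *ᵥ x = c • x := by
  ext u
  by_cases hu : u ∈ T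
  · rw [← hx]
    refine Finset.sum_congr rfl fun w _ => ?_
    by_cases hw : w ∈ T
    · simp [zeroOutside_apply, hu, hw]
    · simp [hT w hw]
  · rw [zeroOutside_mulVec_of_notMem T x hu, Pi.smul_apply, hT u hu, smul_zero]

lemma pow_mulVec_of_eigenvector {x : V → ℝ} {c : ℝ} (hx : A *ᵥ x = c • x) (k : ℕ) :
    A ^ k *ᵥ x = c ^ k • x := by
  induction k with
  | zero => simp
  | succ k ih => rw [pow_succ', ← mulVec_mulVec, ih, mulVec_smul, hx, smul_smul, pow_succ]

lemma pow_apply_le_pow_apply {B : Matrix V V ℝ} (hB : ∀ u w, 0 ≤ B u w)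
    (hBA : ∀ u w, B u w ≤ A u w) (k : ℕ) (u w : V) : (B ^ k) u w ≤ (A ^ k) u w := by
  have hA : ∀ u w, 0 ≤ A u w := fun u w => (hB u w).trans (hBA u w)
  induction k generalizing w with
  | zero => simp
  | succ k ih =>
    rw [pow_succ, pow_succ, mul_apply, mul_apply]
    exact Finset.sum_le_sum fun y _ =>
      mul_le_mul (ih y) (hBA y w) (hB y w) (pow_apply_nonneg hA k u y)

omit [DecidableEq V] in
lemma mulVec_nonneg_of_nonneg (hnn : ∀ u w, 0 ≤ A u w) {x : V → ℝ} (hx : ∀ u, 0 ≤ x u) (u : V) :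
    0 ≤ (A *ᵥ x) u :=
  Finset.sum_nonneg fun w _ => mul_nonneg (hnn u w) (hx w)

lemma IsSymm.pow_two_mul_apply_self (hA : A.IsSymm) (r : ℕ) (u : V) :
    (A ^ (2 * r)) u u = ∑ w, ((A ^ r) u w) ^ 2 := by
  rw [two_mul, pow_add, mul_apply]
  exact Finset.sum_congr rfl fun w _ => by rw [sq, (hA.pow r).apply u w]

end Matrix

namespace SimpleGraph

open Matrix

variable {V : Type*} [Fintype V] [DecidableEq V] {G : SimpleGraph V} [DecidableRel G.Adj]

omit [Fintype V] [DecidableEq V] in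
lemma adjMatrix_apply_nonneg (u w : V) : 0 ≤ G.adjMatrix ℝ u w := by
  rw [adjMatrix_apply]
  split_ifs <;> norm_num

lemma Connected.exists_pow_zeroOutside_add_one_le (hG : G.Connected)
    (hnb : ∀ v, ∃ w, G.Adj v w) {T : Finset V} {u z : V} (hu : u ∈ T) (hz : z ∉ T) {r : ℕ}
    (hr : G.dist u z ≤ r) :
    ∃ w, (((G.adjMatrix ℝ).zeroOutside T) ^ r) u w + 1 ≤ ((G.adjMatrix ℝ) ^ r) u w := by
  set A := G.adjMatrix ℝ with hAdef
  have hnn : ∀ u w, 0 ≤ A u w := adjMatrix_apply_nonneg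
  induction r, hr using Nat.le_induction with
  | base =>
    refine ⟨z, ?_⟩
    have hpos : 0 < G.dist u z := hG.pos_dist_of_ne (by rintro rfl; exact hz hu)
    obtain ⟨k, hk⟩ := Nat.exists_eq_succ_of_ne_zero hpos.ne'
    have h0 : ((A.zeroOutside T) ^ (G.dist u z)) u z = 0 := by
      rw [hk, pow_succ, mul_apply]
      exact Finset.sum_eq_zero fun y _ => by simp [zeroOutside_apply, hz]
    rw [h0, zero_add, hAdef, adjMatrix_pow_apply_eq_card_walk]
    obtain ⟨p, hp⟩ := hG.exists_walk_length_eq_dist u z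
    have : 0 < Fintype.card {p : G.Walk u z | p.length = G.dist u z} :=
      Fintype.card_pos_iff.2 ⟨⟨p, hp⟩⟩
    exact_mod_cast this
  | succ r hr ih =>
    obtain ⟨w, hw⟩ := ih
    obtain ⟨w', hadj⟩ := hnb w
    refine ⟨w', ?_⟩
    have hle := fun y => pow_apply_le_pow_apply (zeroOutside_nonneg hnn T)
      (zeroOutside_le hnn T) r u y
    have h1 : A w w' = 1 := by simp [hAdef, hadj]
    rw [pow_succ, pow_succ, mul_apply, mul_apply]
    have hsum : ∑ y, (if y = w then (1 : ℝ) else 0) * A y w' = 1 := by simp [h1]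
    rw [← hsum, ← Finset.sum_add_distrib]
    refine Finset.sum_le_sum fun y _ => ?_
    have h2 : (A.zeroOutside T ^ r) u y + (if y = w then (1 : ℝ) else 0) ≤ (A ^ r) u y := by
      split_ifs with h
      · rw [h]; exact hw
      · simpa using hle y
    calc _ ≤ (A.zeroOutside T ^ r) u y * A y w' + (if y = w then (1 : ℝ) else 0) * A y w' :=
          add_le_add_left (mul_le_mul_of_nonneg_left (zeroOutside_le hnn T y w')
            (pow_apply_nonneg (zeroOutside_nonneg hnn T) r u y)) _
      _ ≤ _ := by
          rw [← add_mul]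
          exact mul_le_mul_of_nonneg_right h2 (hnn y w')

lemma Connected.pow_zeroOutside_apply_self_add_one_le (hG : G.Connected)
    (hnb : ∀ v, ∃ w, G.Adj v w) {T : Finset V} {u z : V} (hu : u ∈ T) (hz : z ∉ T) {r : ℕ}
    (hr : G.dist u z ≤ r) :
    (((G.adjMatrix ℝ).zeroOutside T) ^ (2 * r)) u u + 1 ≤ ((G.adjMatrix ℝ) ^ (2 * r)) u u := by
  obtain ⟨w, hw⟩ := hG.exists_pow_zeroOutside_add_one_le hnb hu hz hr
  have hA : (G.adjMatrix ℝ).IsSymm := G.isSymm_adjMatrix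
  have hnn : ∀ u w, 0 ≤ G.adjMatrix ℝ u w := adjMatrix_apply_nonneg
  rw [hA.pow_two_mul_apply_self, (hA.zeroOutside T).pow_two_mul_apply_self]
  have hsum : ∑ y, (if y = w then (1 : ℝ) else 0) = 1 := by simp
  rw [← hsum, ← Finset.sum_add_distrib]
  refine Finset.sum_le_sum fun y _ => ?_
  have h0 := pow_apply_nonneg (zeroOutside_nonneg hnn T) r u y
  split_ifs with h
  · subst h
    nlinarith
  · have := pow_apply_le_pow_apply (zeroOutside_nonneg hnn T) (zeroOutside_le hnn T) r u y
    nlinarith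

/-- Deleting a net from a connected graph shrinks the lengths of the images of nonnegative vectors
under a power of the adjacency matrix. -/
lemma Connected.pow_zeroOutside_mulVec_add_le (hG : G.Connected)
    (hnb : ∀ v, ∃ w, G.Adj v w) {T : Finset V} {r : ℕ}
    (hT : ∀ u ∈ T, ∃ z ∉ T, G.dist u z ≤ r) {x : V → ℝ} (hx : ∀ u, 0 ≤ x u)
    (hxT : ∀ u ∉ T, x u = 0) :
    ((G.adjMatrix ℝ).zeroOutside T ^ r *ᵥ x) ⬝ᵥ ((G.adjMatrix ℝ).zeroOutside T ^ r *ᵥ x) + x ⬝ᵥ x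
      ≤ (G.adjMatrix ℝ ^ r *ᵥ x) ⬝ᵥ (G.adjMatrix ℝ ^ r *ᵥ x) := by
  have hA : (G.adjMatrix ℝ).IsSymm := G.isSymm_adjMatrix
  have hnn : ∀ u w, 0 ≤ G.adjMatrix ℝ u w := adjMatrix_apply_nonneg
  rw [hA.mulVec_dotProduct_mulVec_pow, (hA.zeroOutside T).mulVec_dotProduct_mulVec_pow]
  nth_rewrite 4 [← one_mulVec x]
  rw [← dotProduct_add, ← add_mulVec]
  refine Finset.sum_le_sum fun u _ => ?_
  by_cases hu : u ∈ T
  swap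
  · rw [hxT u hu, zero_mul, zero_mul]
  refine mul_le_mul_of_nonneg_left ?_ (hx u)
  refine Finset.sum_le_sum fun w _ => mul_le_mul_of_nonneg_right ?_ (hx w)
  obtain ⟨z, hz, hd⟩ := hT u hu
  beta_reduce
  rw [Matrix.add_apply, one_apply]
  split_ifs with h
  · subst h
    exact hG.pow_zeroOutside_apply_self_add_one_le hnb hu hz hd
  · simpa using pow_apply_le_pow_apply (zeroOutside_nonneg hnn T) (zeroOutside_le hnn T) (2 * r) u w

end SimpleGraph

namespace SimpleGraph

open Matrix

variable {V : Type*} [Fintype V] [DecidableEq V] {G : SimpleGraph V}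

lemma Connected.pow_mulVec_eq_zero_of_lt_dist (hG : G.Connected) {N : Matrix V V ℝ}
    (hN : ∀ u w, N u w ≠ 0 → G.Adj u w) {v : V} {ρ : ℕ} {x : V → ℝ}
    (hx : ∀ u, ρ < G.dist v u → x u = 0) (k : ℕ) {u : V} (hu : ρ + k < G.dist v u) :
    (N ^ k *ᵥ x) u = 0 := by
  induction k generalizing u with
  | zero => simpa using hx u hu
  | succ k ih =>
    rw [pow_succ', ← mulVec_mulVec]
    refine Finset.sum_eq_zero fun w _ => ?_
    by_cases h : N u w = 0
    · beta_reduce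
      rw [h, zero_mul]
    · have := hG.dist_le_succ_of_adj (v := v) (hN u w h).symm
      rw [ih (by omega), mul_zero]

variable [DecidableRel G.Adj]

omit [Fintype V] [DecidableEq V] in
lemma adj_of_adjMatrix_ne_zero (u w : V) (h : G.adjMatrix ℝ u w ≠ 0) : G.Adj u w := by
  by_contra hcon
  exact h (by simp [hcon])

omit [Fintype V] in
lemma adj_of_zeroOutside_adjMatrix_ne_zero (T : Finset V) (u w : V)
    (h : (G.adjMatrix ℝ).zeroOutside T u w ≠ 0) : G.Adj u w := by
  rw [zeroOutside_apply] at h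
  split_ifs at h
  exacts [adj_of_adjMatrix_ne_zero u w h, absurd rfl h]

lemma Connected.pow_adjMatrix_mulVec_dotProduct_self_le (hG : G.Connected) {v : V} {R ρ k : ℕ}
    {c : ℝ} (hc : 0 < c)
    (hball : ∀ x : V → ℝ, (∀ u, R < G.dist v u → x u = 0) →
      x ⬝ᵥ G.adjMatrix ℝ *ᵥ x ≤ c * (x ⬝ᵥ x))
    {x : V → ℝ} (hx : ∀ u, ρ < G.dist v u → x u = 0) (hk : ρ + k ≤ R) :
    (G.adjMatrix ℝ ^ k *ᵥ x) ⬝ᵥ (G.adjMatrix ℝ ^ k *ᵥ x) ≤ c ^ (2 * k) * (x ⬝ᵥ x) := by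
  induction k with
  | zero => simp
  | succ k ih =>
    have hsupp : ∀ l ≤ k + 1, ∀ u, R < G.dist v u → (G.adjMatrix ℝ ^ l *ᵥ x) u = 0 :=
      fun l hl u hu =>
        hG.pow_mulVec_eq_zero_of_lt_dist adj_of_adjMatrix_ne_zero hx l (by omega)
    have hsucc : G.adjMatrix ℝ ^ (k + 1) *ᵥ x = G.adjMatrix ℝ *ᵥ (G.adjMatrix ℝ ^ k *ᵥ x) := by
      rw [mulVec_mulVec, pow_succ']
    have hstep := IsSymm.mulVec_dotProduct_self_le (D := {u | G.dist v u ≤ R})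
      (G.isSymm_adjMatrix (α := ℝ)) adjMatrix_apply_nonneg hc
      (fun y hy => hball y fun u hu => hy u (by simpa using hu))
      (y := G.adjMatrix ℝ ^ k *ᵥ x)
      (fun u hu => hsupp k (by omega) u (by simpa using hu))
      (fun u hu => by rw [← hsucc]; exact hsupp (k + 1) le_rfl u (by simpa using hu))
    rw [hsucc]
    calc _ ≤ c ^ 2 * _ := hstep
      _ ≤ c ^ 2 * (c ^ (2 * k) * (x ⬝ᵥ x)) :=
        mul_le_mul_of_nonneg_left (ih (by omega)) (by positivity)
      _ = _ := by ring

lemma Connected.pow_zeroOutside_mulVec_single_dotProduct_self_le (hG : G.Connected)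
    (hnb : ∀ v, ∃ w, G.Adj v w) {T : Finset V} {r q : ℕ}
    (hT : ∀ u ∈ T, ∃ z ∉ T, G.dist u z ≤ r) {c : ℝ} (hc : 1 ≤ c) {v : V} (hv : v ∈ T)
    (hball : ∀ x : V → ℝ, (∀ u, r * q < G.dist v u → x u = 0) →
      x ⬝ᵥ G.adjMatrix ℝ *ᵥ x ≤ c * (x ⬝ᵥ x)) :
    ((G.adjMatrix ℝ).zeroOutside T ^ (r * q) *ᵥ Pi.single v 1) ⬝ᵥ
      ((G.adjMatrix ℝ).zeroOutside T ^ (r * q) *ᵥ Pi.single v 1) ≤ (c ^ (2 * r) - 1) ^ q := by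
  set B := (G.adjMatrix ℝ).zeroOutside T with hB
  have hBnn : ∀ u w, 0 ≤ B u w := zeroOutside_nonneg adjMatrix_apply_nonneg T
  have hc1 : 0 ≤ c ^ (2 * r) - 1 := sub_nonneg.2 (one_le_pow₀ hc)
  have hT0 : ∀ k, ∀ u ∉ T, (B ^ k *ᵥ (Pi.single v 1 : V → ℝ)) u = 0 := by
    intro k u hu
    cases k with
    | zero =>
      rw [pow_zero, one_mulVec, Pi.single_eq_of_ne]
      rintro rfl
      exact hu hv
    | succ k =>
      rw [pow_succ', ← mulVec_mulVec]
      exact zeroOutside_mulVec_of_notMem T _ hu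
  have hnn : ∀ k u, 0 ≤ (B ^ k *ᵥ (Pi.single v 1 : V → ℝ)) u := fun k =>
    mulVec_nonneg_of_nonneg (fun u w => pow_apply_nonneg hBnn k u w) fun u => by
      rw [Pi.single_apply]
      split_ifs <;> norm_num
  have hsingle : ∀ u, 0 < G.dist v u → (Pi.single v 1 : V → ℝ) u = 0 := fun u hu => by
    rw [Pi.single_eq_of_ne]
    rintro rfl
    simp at hu
  have key : ∀ i ≤ q, (B ^ (r * i) *ᵥ Pi.single v 1) ⬝ᵥ (B ^ (r * i) *ᵥ Pi.single v 1)
      ≤ (c ^ (2 * r) - 1) ^ i := by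
    intro i
    induction i with
    | zero => simp [dotProduct, Matrix.one_apply]
    | succ i ih =>
      intro hi
      have hsupp : ∀ u, r * i < G.dist v u → (B ^ (r * i) *ᵥ (Pi.single v 1 : V → ℝ)) u = 0 :=
        fun u hu => hG.pow_mulVec_eq_zero_of_lt_dist (adj_of_zeroOutside_adjMatrix_ne_zero T)
          hsingle (r * i) (by omega)
      have h1 := hG.pow_zeroOutside_mulVec_add_le hnb hT (hnn (r * i)) (hT0 (r * i))
      have h2 := hG.pow_adjMatrix_mulVec_dotProduct_self_le (k := r) (by linarith) hball hsupp
        (by rw [← Nat.mul_succ]; exact Nat.mul_le_mul_left _ hi)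
      have h3 : B ^ (r * (i + 1)) *ᵥ (Pi.single v 1 : V → ℝ)
          = B ^ r *ᵥ (B ^ (r * i) *ᵥ Pi.single v 1) := by
        rw [mulVec_mulVec, ← pow_add, Nat.mul_succ, add_comm]
      rw [← hB] at h1
      rw [h3, pow_succ']
      have h4 := mul_le_mul_of_nonneg_left (ih (by omega)) hc1
      linarith
  exact key q le_rfl

lemma Connected.sum_sq_pow_zeroOutside_le (hG : G.Connected)
    (hnb : ∀ v, ∃ w, G.Adj v w) {T : Finset V} {r q : ℕ} (hrq : r * q ≠ 0)
    (hT : ∀ u ∈ T, ∃ z ∉ T, G.dist u z ≤ r) {c : ℝ} (hc : 1 ≤ c)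
    (hball : ∀ v ∈ T, ∀ x : V → ℝ, (∀ u, r * q < G.dist v u → x u = 0) →
      x ⬝ᵥ G.adjMatrix ℝ *ᵥ x ≤ c * (x ⬝ᵥ x)) :
    ∑ u, ∑ v, (((G.adjMatrix ℝ).zeroOutside T ^ (r * q)) u v) ^ 2
      ≤ Fintype.card V * (c ^ (2 * r) - 1) ^ q := by
  rw [Finset.sum_comm, ← nsmul_eq_mul, ← Finset.card_univ]
  refine Finset.sum_le_card_nsmul _ _ _ fun v _ => ?_
  by_cases hv : v ∈ T
  · have h := hG.pow_zeroOutside_mulVec_single_dotProduct_self_le hnb hT hc hv (hball v hv)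
    rw [mulVec_single_one] at h
    simpa only [dotProduct, col_apply, ← sq] using h
  · obtain ⟨k, hk⟩ := Nat.exists_eq_succ_of_ne_zero hrq
    have h0 : ∀ u, ((G.adjMatrix ℝ).zeroOutside T ^ (r * q)) u v = 0 := fun u => by
      rw [hk, pow_succ, mul_apply]
      exact Finset.sum_eq_zero fun w _ => by simp [zeroOutside_apply, hv]
    simp only [h0]
    simpa using pow_nonneg (sub_nonneg.2 (one_le_pow₀ hc)) q

end SimpleGraph

namespace Matrix

variable {V : Type*} [Fintype V] {A : Matrix V V ℝ}

lemma IsSymm.exists_orthonormalBasis_of_charpoly_eq [DecidableEq V] (hA : A.IsSymm)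
    {lam : V → ℝ} (h : A.charpoly = ∏ i, (X - Polynomial.C (lam i))) :
    ∃ b : OrthonormalBasis V ℝ (EuclideanSpace ℝ V),
      ∀ i, A *ᵥ (b i).ofLp = lam i • (b i).ofLp := by
  have hH : A.IsHermitian := by
    rw [IsHermitian, conjTranspose_eq_transpose_of_trivial]
    exact hA
  have hroots : ∀ f : V → ℝ, (∏ i, (X - Polynomial.C (f i))).roots
      = Finset.univ.val.map f := fun f => by
    rw [Polynomial.roots_prod _ _ (Finset.prod_ne_zero_iff.2 fun i _ => X_sub_C_ne_zero _)]
    simp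
  have hmult : Finset.univ.val.map lam = Finset.univ.val.map hH.eigenvalues := by
    rw [← hroots, ← h, hH.charpoly_eq, ← hroots]
    rfl
  have hfib : ∀ c, Nonempty ({i // lam i = c} ≃ {i // hH.eigenvalues i = c}) := fun c => by
    refine Fintype.card_eq.1 ?_
    have := congrArg (Multiset.count c) hmult
    simp only [Multiset.count_map, ← Finset.filter_val, Finset.card_val] at this
    simpa only [Fintype.card_subtype, eq_comm] using this
  let σ : V ≃ V := Equiv.ofFiberEquiv fun c => (hfib c).some
  have hσ : ∀ i, hH.eigenvalues (σ i) = lam i := Equiv.ofFiberEquiv_map _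
  refine ⟨hH.eigenvectorBasis.reindex σ.symm, fun i => ?_⟩
  rw [OrthonormalBasis.reindex_apply, Equiv.symm_symm, hH.mulVec_eigenvectorBasis, hσ]

variable {lam : V → ℝ} (b : OrthonormalBasis V ℝ (EuclideanSpace ℝ V))

lemma _root_.OrthonormalBasis.sum_dotProduct_mul_dotProduct (x y : V → ℝ) :
    ∑ i, ((b i).ofLp ⬝ᵥ x) * ((b i).ofLp ⬝ᵥ y) = x ⬝ᵥ y := by
  have := b.sum_inner_mul_inner (WithLp.toLp 2 x) (WithLp.toLp 2 y)
  simp only [EuclideanSpace.inner_eq_star_dotProduct, star_trivial] at this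
  rw [dotProduct_comm x y, ← this]
  refine Finset.sum_congr rfl fun i _ => ?_
  rw [dotProduct_comm y]

lemma IsSymm.dotProduct_mulVec_eq_sum (hA : A.IsSymm)
    (hb : ∀ i, A *ᵥ (b i).ofLp = lam i • (b i).ofLp) (x : V → ℝ) :
    x ⬝ᵥ A *ᵥ x = ∑ i, lam i * ((b i).ofLp ⬝ᵥ x) ^ 2 := by
  rw [← b.sum_dotProduct_mul_dotProduct]
  refine Finset.sum_congr rfl fun i _ => ?_
  rw [hA.dotProduct_mulVec_comm, hb, smul_dotProduct, smul_eq_mul]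
  ring

/-- A family of vectors, pairwise orthogonal for both the dot product and the form of `A`, whose
Rayleigh quotients all exceed `c` is no larger than the number of eigenvalues exceeding `c`. -/
lemma IsSymm.card_le_card_filter_lt {ι : Type*} [Fintype ι] (hA : A.IsSymm)
    (hb : ∀ i, A *ᵥ (b i).ofLp = lam i • (b i).ofLp) {c : ℝ} {x : ι → V → ℝ}
    (hx : ∀ k, c * (x k ⬝ᵥ x k) < x k ⬝ᵥ A *ᵥ x k)
    (horth : ∀ k l, k ≠ l → x k ⬝ᵥ x l = 0) (hAorth : ∀ k l, k ≠ l → x k ⬝ᵥ A *ᵥ x l = 0) :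
    Fintype.card ι ≤ (Finset.univ.filter fun i => c < lam i).card := by
  classical
  by_contra! hlt
  let M : Matrix {i // c < lam i} ι ℝ := of fun i k => (b i).ofLp ⬝ᵥ x k
  obtain ⟨a, ha, ha0⟩ : ∃ a : ι → ℝ, a ∈ LinearMap.ker M.mulVecLin ∧ a ≠ 0 := by
    refine (Submodule.ne_bot_iff _).1 (LinearMap.ker_ne_bot_of_finrank_lt ?_)
    simpa [Fintype.card_subtype] using hlt
  set y : V → ℝ := ∑ k, a k • x k with hy
  have hyb : ∀ i, c < lam i → (b i).ofLp ⬝ᵥ y = 0 := fun i hi => by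
    have h := congrFun (LinearMap.mem_ker.1 ha) ⟨i, hi⟩
    rw [hy, dotProduct_sum]
    simp only [mulVecLin_apply, mulVec, dotProduct, M, of_apply, Pi.zero_apply] at h
    rw [← h]
    refine Finset.sum_congr rfl fun k _ => ?_
    rw [dotProduct_smul, smul_eq_mul, mul_comm]
    rfl
  have hle : y ⬝ᵥ A *ᵥ y ≤ c * (y ⬝ᵥ y) := by
    rw [hA.dotProduct_mulVec_eq_sum b hb, ← b.sum_dotProduct_mul_dotProduct, Finset.mul_sum]
    refine Finset.sum_le_sum fun i _ => ?_
    by_cases hi : c < lam i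
    · simp [hyb i hi]
    · rw [← sq]
      exact mul_le_mul_of_nonneg_right (not_lt.1 hi) (sq_nonneg _)
  have hform : ∀ B : Matrix V V ℝ, (∀ k l, k ≠ l → x k ⬝ᵥ B *ᵥ x l = 0) →
      y ⬝ᵥ B *ᵥ y = ∑ k, a k ^ 2 * (x k ⬝ᵥ B *ᵥ x k) := fun B hB => by
    rw [hy, sum_dotProduct]
    refine Finset.sum_congr rfl fun k _ => ?_
    rw [mulVec_sum, dotProduct_sum, Finset.sum_eq_single k]
    · rw [smul_dotProduct, mulVec_smul, dotProduct_smul, smul_eq_mul, smul_eq_mul]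
      ring
    · intro l _ hl
      rw [smul_dotProduct, mulVec_smul, dotProduct_smul, hB k l hl.symm, smul_zero, smul_zero]
    · simp
  have hone := hform 1 (by simpa using horth)
  simp only [one_mulVec] at hone
  rw [hform A hAorth, hone, Finset.mul_sum] at hle
  obtain ⟨k, hk⟩ := Function.ne_iff.1 ha0
  refine hle.not_gt (Finset.sum_lt_sum (fun l _ => ?_) ⟨k, Finset.mem_univ k, ?_⟩)
  · have := mul_le_mul_of_nonneg_left (hx l).le (sq_nonneg (a l))
    linarith
  · have := mul_lt_mul_of_pos_left (hx k) (pow_pos (abs_pos.2 hk) 2)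
    rw [sq_abs] at this
    linarith

lemma sum_sq_mulVec_le {ι : Type*} [Fintype ι] (N : Matrix V V ℝ)
    {w : ι → EuclideanSpace ℝ V} (hw : Orthonormal ℝ w) :
    ∑ i, (N *ᵥ (w i).ofLp) ⬝ᵥ (N *ᵥ (w i).ofLp) ≤ ∑ u, ∑ v, N u v ^ 2 := by
  simp only [dotProduct]
  rw [Finset.sum_comm]
  refine Finset.sum_le_sum fun u _ => ?_
  have h := hw.sum_inner_products_le (s := Finset.univ) (x := WithLp.toLp 2 (N u))
  rw [EuclideanSpace.real_norm_sq_eq] at h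
  refine le_trans (le_of_eq (Finset.sum_congr rfl fun i _ => ?_)) h
  rw [← sq, Real.norm_eq_abs, sq_abs, EuclideanSpace.inner_eq_star_dotProduct]
  rfl

/-- If `N` scales by `μ` every `c`-eigenvector of `A` that vanishes on `Z`, then the Frobenius norm
of `N` bounds the multiplicity of the eigenvalue `c` of `A`. -/
lemma card_filter_sub_mul_sq_le [DecidableEq V]
    (hb : ∀ i, A *ᵥ (b i).ofLp = lam i • (b i).ofLp) {c μ : ℝ} {Z : Finset V}
    {N : Matrix V V ℝ}
    (hN : ∀ x : V → ℝ, A *ᵥ x = c • x → (∀ z ∈ Z, x z = 0) → N *ᵥ x = μ • x) :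
    (((Finset.univ.filter fun i => lam i = c).card : ℝ) - Z.card) * μ ^ 2
      ≤ ∑ u, ∑ v, N u v ^ 2 := by
  let E : Submodule ℝ (EuclideanSpace ℝ V) := LinearMap.ker (A.toEuclideanLin - c • LinearMap.id)
  have hE : ∀ x : EuclideanSpace ℝ V, x ∈ E ↔ A *ᵥ x.ofLp = c • x.ofLp := fun x => by
    rw [LinearMap.mem_ker, LinearMap.sub_apply, sub_eq_zero]
    exact (WithLp.ofLp_injective 2).eq_iff.symm
  have hcard : (Finset.univ.filter fun i => lam i = c).card ≤ Module.finrank ℝ E := by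
    let f : {i // lam i = c} → E := fun i => ⟨b i, by rw [hE, hb, i.2]⟩
    have hf : LinearIndependent ℝ f := by
      refine LinearIndependent.of_comp E.subtype ?_
      exact b.orthonormal.linearIndependent.comp (fun i : {i // lam i = c} => (i : V))
        Subtype.val_injective
    have := hf.fintype_card_le_finrank
    rwa [Fintype.card_subtype] at this
  let ρ : E →ₗ[ℝ] (Z → ℝ) :=
    { toFun := fun x z => x.1.ofLp z
      map_add' := fun _ _ => rfl
      map_smul' := fun _ _ => rfl }
  have hrank := ρ.finrank_range_add_finrank_ker
  have hrange : Module.finrank ℝ (LinearMap.range ρ) ≤ Z.card := by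
    simpa using Submodule.finrank_le (LinearMap.range ρ)
  let w := stdOrthonormalBasis ℝ (LinearMap.ker ρ)
  have hw : Orthonormal ℝ fun i => ((w i : E) : EuclideanSpace ℝ V) :=
    (w.orthonormal.comp_linearIsometry (LinearMap.ker ρ).subtypeₗᵢ).comp_linearIsometry E.subtypeₗᵢ
  have hsum := sum_sq_mulVec_le N hw
  have hterm : ∀ i, (N *ᵥ ((w i : E) : EuclideanSpace ℝ V).ofLp) ⬝ᵥ
      (N *ᵥ ((w i : E) : EuclideanSpace ℝ V).ofLp) = μ ^ 2 := fun i => by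
    rw [hN _ ((hE _).1 (w i).1.2) fun z hz =>
      congrFun (LinearMap.mem_ker.1 (w i).2) ⟨z, hz⟩]
    have h1 := hw.1 i
    have h2 := EuclideanSpace.real_norm_sq_eq ((w i : E) : EuclideanSpace ℝ V)
    rw [h1] at h2
    rw [smul_dotProduct, dotProduct_smul, smul_eq_mul, smul_eq_mul, dotProduct]
    simp only [← sq]
    rw [← h2]
    ring
  rw [Finset.sum_congr rfl fun i _ => hterm i, Finset.sum_const, nsmul_eq_mul, Finset.card_univ,
    Fintype.card_fin] at hsum
  refine le_trans (mul_le_mul_of_nonneg_right ?_ (sq_nonneg μ)) hsum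
  rw [sub_le_iff_le_add]
  norm_cast
  omega

end Matrix

namespace SimpleGraph

open Matrix

variable {V : Type*} [Fintype V] [DecidableEq V] {G : SimpleGraph V} [DecidableRel G.Adj]
  {lam : V → ℝ} {b : OrthonormalBasis V ℝ (EuclideanSpace ℝ V)}

omit [DecidableEq V] in
/-- Few vertices of a bounded-degree graph are centres of balls whose spectral radius exceeds `c`,
if few eigenvalues of the graph exceed `c`. -/
lemma Connected.exists_card_le_and_forall_notMem_form_le (hG : G.Connected) {d : ℕ}
    (hd : ∀ v, G.degree v ≤ d)
    (hb : ∀ i, G.adjMatrix ℝ *ᵥ (b i).ofLp = lam i • (b i).ofLp) (c : ℝ) (R : ℕ) :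
    ∃ U : Finset V,
      U.card ≤ (Finset.univ.filter fun i => c < lam i).card * (d + 1) ^ (2 * R + 1) ∧
      ∀ v ∉ U, ∀ x : V → ℝ, (∀ u, R < G.dist v u → x u = 0) →
        x ⬝ᵥ G.adjMatrix ℝ *ᵥ x ≤ c * (x ⬝ᵥ x) := by
  classical
  let U : Finset V := Finset.univ.filter fun v => ∃ x : V → ℝ,
    (∀ u, R < G.dist v u → x u = 0) ∧ c * (x ⬝ᵥ x) < x ⬝ᵥ G.adjMatrix ℝ *ᵥ x
  refine ⟨U, ?_, fun v hv x hx => ?_⟩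
  swap
  · by_contra! h
    exact hv (Finset.mem_filter.2 ⟨Finset.mem_univ v, x, hx, h⟩)
  obtain ⟨W, hWU, hsep, hcov⟩ := G.exists_separated_cover U (2 * R + 1)
  have hx : ∀ w : W, ∃ x : V → ℝ, (∀ u, R < G.dist w u → x u = 0) ∧
      c * (x ⬝ᵥ x) < x ⬝ᵥ G.adjMatrix ℝ *ᵥ x := fun w => (Finset.mem_filter.1 (hWU w.2)).2
  choose x hsupp hform using hx
  have hfar : ∀ k l : W, k ≠ l → ∀ u v, G.dist u v ≤ 1 → x k u = 0 ∨ x l v = 0 := by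
    intro k l hkl u v huv
    have h1 := hsep k k.2 l l.2 (Subtype.coe_ne_coe.2 hkl)
    have h2 := hG.dist_triangle (u := (k : V)) (v := u) (w := l)
    have h3 := hG.dist_triangle (u := u) (v := v) (w := l)
    rw [G.dist_comm (u := v)] at h3
    by_cases h : R < G.dist k u
    · exact Or.inl (hsupp k u h)
    · exact Or.inr (hsupp l v (by omega))
  have hW : W.card ≤ (Finset.univ.filter fun i => c < lam i).card := by
    rw [← Fintype.card_coe W]
    refine (G.isSymm_adjMatrix (α := ℝ)).card_le_card_filter_lt b hb hform ?_ ?_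
    · intro k l hkl
      refine Finset.sum_eq_zero fun u _ => mul_eq_zero.2 (hfar k l hkl u u ?_)
      simp
    · intro k l hkl
      simp only [dotProduct, mulVec, Finset.mul_sum]
      refine Finset.sum_eq_zero fun u _ => Finset.sum_eq_zero fun v _ => ?_
      by_cases h : G.Adj u v
      · rcases hfar k l hkl u v (dist_eq_one_iff_adj.2 h).le with h0 | h0 <;> simp [h0]
      · simp [h]
  calc U.card ≤ (W.biUnion fun w => G.distBall w (2 * R + 1)).card := by
        refine Finset.card_le_card fun u hu => ?_
        obtain ⟨w, hw, hwu⟩ := hcov u hu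
        exact Finset.mem_biUnion.2 ⟨w, hw, mem_distBall.2 hwu⟩
    _ ≤ W.card * (d + 1) ^ (2 * R + 1) :=
        Finset.card_biUnion_le_card_mul _ _ _ fun w _ => hG.card_distBall_le hd w _
    _ ≤ _ := Nat.mul_le_mul_right _ hW

lemma eigenvalue_adjMatrix_le {d : ℕ} (hd : ∀ v, G.degree v ≤ d) {c : ℝ} {x : V → ℝ} (hx : x ≠ 0)
    (h : G.adjMatrix ℝ *ᵥ x = c • x) : c ≤ d := by
  have hev : Module.End.HasEigenvalue (Matrix.toLin' (G.adjMatrix ℝ)) c :=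
    Module.End.hasEigenvalue_of_hasEigenvector (x := x)
      ⟨Module.End.mem_eigenspace_iff.2 (by rw [toLin'_apply, h]), hx⟩
  obtain ⟨k, hk⟩ := eigenvalue_mem_ball hev
  rw [Metric.mem_closedBall, Real.dist_eq, adjMatrix_apply, if_neg (G.irrefl), sub_zero] at hk
  calc c ≤ |c| := le_abs_self c
    _ ≤ _ := hk
    _ ≤ ∑ l, ‖G.adjMatrix ℝ k l‖ :=
      Finset.sum_le_sum_of_subset_of_nonneg (Finset.erase_subset _ _) fun _ _ _ => norm_nonneg _
    _ = ∑ l, G.adjMatrix ℝ k l :=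
      Finset.sum_congr rfl fun l _ => Real.norm_of_nonneg (adjMatrix_apply_nonneg k l)
    _ = G.degree k := by simp [adjMatrix_apply, ← card_neighborFinset_eq_degree,
        neighborFinset_eq_filter]
    _ ≤ d := by exact_mod_cast hd k

omit [DecidableEq V] in
lemma one_le_of_form_le {v w : V} (h : G.Adj v w) {R : ℕ} (hR : R ≠ 0) {c : ℝ}
    (hball : ∀ x : V → ℝ, (∀ u, R < G.dist v u → x u = 0) →
      x ⬝ᵥ G.adjMatrix ℝ *ᵥ x ≤ c * (x ⬝ᵥ x)) : 1 ≤ c := by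
  classical
  have hvw : v ≠ w := h.ne
  have := hball (Pi.single v 1 + Pi.single w 1) fun u hu => by
    have hv : u ≠ v := by rintro rfl; simp at hu
    have hw : u ≠ w := by
      rintro rfl
      rw [dist_eq_one_iff_adj.2 h] at hu
      omega
    simp [hv, hw]
  simp [mulVec_add, add_dotProduct, dotProduct_add, h, h.symm, hvw, hvw.symm] at this
  linarith

/-- The multiplicity bound with free parameters: `2 * s` is the covering radius of the deleted net
and `2 * s * q` the radius of the balls considered. -/
lemma Connected.card_eigenvalue_eq_le [Nontrivial V] (hG : G.Connected) {d : ℕ}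
    (hd : ∀ v, G.degree v ≤ d)
    (hb : ∀ i, G.adjMatrix ℝ *ᵥ (b i).ofLp = lam i • (b i).ofLp) (c : ℝ) {s q : ℕ}
    (hs : s ≠ 0) (hq : q ≠ 0) (hsV : s < Fintype.card V) :
    ((Finset.univ.filter fun i => lam i = c).card : ℝ) ≤
      Fintype.card V / (s + 1) +
      (Finset.univ.filter fun i => c < lam i).card * (d + 1) ^ (2 * (2 * s * q) + 1) +
      Fintype.card V * Real.exp (-(q / (d + 1) ^ (4 * s))) := by
  have hnb : ∀ v, ∃ w, G.Adj v w := hG.preconnected.exists_adj_of_nontrivial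
  obtain ⟨Z, hZ, hnet⟩ := hG.exists_net hsV
  obtain ⟨U, hU, hball⟩ := hG.exists_card_le_and_forall_notMem_form_le hd hb c (2 * s * q)
  have hZU : ((Z ∪ U).card : ℝ) ≤ Fintype.card V / (s + 1) +
      (Finset.univ.filter fun i => c < lam i).card * (d + 1) ^ (2 * (2 * s * q) + 1) := by
    have h1 : (Z.card : ℝ) ≤ Fintype.card V / (s + 1) := by
      rw [le_div_iff₀ (by positivity)]
      exact_mod_cast hZ
    have h2 : (U.card : ℝ) ≤
        (Finset.univ.filter fun i => c < lam i).card * (d + 1) ^ (2 * (2 * s * q) + 1) := by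
      exact_mod_cast hU
    have h3 : ((Z ∪ U).card : ℝ) ≤ Z.card + U.card := by exact_mod_cast Finset.card_union_le Z U
    linarith
  suffices h : ((Finset.univ.filter fun i => lam i = c).card : ℝ) - (Z ∪ U).card ≤
      Fintype.card V * Real.exp (-(q / (d + 1) ^ (4 * s))) by linarith
  by_cases hmult : (Finset.univ.filter fun i => lam i = c).card ≤ (Z ∪ U).card
  · have : ((Finset.univ.filter fun i => lam i = c).card : ℝ) ≤ (Z ∪ U).card := by
      exact_mod_cast hmult
    exact (sub_nonpos.2 this).trans (by positivity)
  have hT : (Z ∪ U)ᶜ.Nonempty := by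
    rw [Finset.nonempty_iff_ne_empty, ne_eq, Finset.compl_eq_empty_iff]
    intro h
    exact hmult (Finset.card_le_card fun i _ => h.ge (Finset.mem_univ i))
  have hballT : ∀ v ∈ (Z ∪ U)ᶜ, ∀ x : V → ℝ, (∀ u, 2 * s * q < G.dist v u → x u = 0) →
      x ⬝ᵥ G.adjMatrix ℝ *ᵥ x ≤ c * (x ⬝ᵥ x) := fun v hv =>
    hball v fun h => Finset.mem_compl.1 hv (Finset.mem_union_right _ h)
  have hR : 2 * s * q ≠ 0 := by positivity
  obtain ⟨v, hv⟩ := hT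
  obtain ⟨w, hvw⟩ := hnb v
  have hc : 1 ≤ c := one_le_of_form_le hvw hR (hballT v hv)
  obtain ⟨i, hi⟩ : (Finset.univ.filter fun i => lam i = c).Nonempty :=
    Finset.card_pos.1 (by omega)
  have hcd : c ≤ d + 1 := by
    rw [← (Finset.mem_filter.1 hi).2]
    have := eigenvalue_adjMatrix_le hd (x := (b i).ofLp)
      (fun h => b.orthonormal.ne_zero i ((WithLp.ofLp_eq_zero 2).1 h)) (hb i)
    linarith
  have hfrob := hG.sum_sq_pow_zeroOutside_le hnb hR
    (fun u _ => by
      obtain ⟨z, hz, hdz⟩ := hnet u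
      exact ⟨z, by simp [hz], by rwa [dist_comm]⟩) hc hballT
  have hlow := card_filter_sub_mul_sq_le b hb (c := c) (μ := c ^ (2 * s * q)) (Z := Z ∪ U)
    (N := (G.adjMatrix ℝ).zeroOutside (Z ∪ U)ᶜ ^ (2 * s * q)) fun x hx hxZ =>
      pow_mulVec_of_eigenvector (zeroOutside_mulVec_of_eigenvector hx fun u hu =>
        hxZ u (by rwa [Finset.mem_compl, not_not] at hu)) _
  have hc4 : 1 ≤ c ^ (4 * s) := one_le_pow₀ hc
  have hsq : (c ^ (2 * s * q)) ^ 2 = (c ^ (4 * s)) ^ q := by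
    rw [← pow_mul, ← pow_mul]
    congr 1
    ring
  have hexp : (c ^ (4 * s) - 1) ^ q
      ≤ Real.exp (-(q / (d + 1) ^ (4 * s))) * (c ^ (4 * s)) ^ q := by
    have hle : c ^ (4 * s) ≤ ((d : ℝ) + 1) ^ (4 * s) := pow_le_pow_left₀ (by linarith) hcd _
    have h1 : 1 - 1 / c ^ (4 * s) ≤ Real.exp (-(1 / ((d : ℝ) + 1) ^ (4 * s))) := by
      have h2 := Real.add_one_le_exp (-(1 / ((d : ℝ) + 1) ^ (4 * s)))
      have h3 := one_div_le_one_div_of_le (by linarith) hle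
      linarith
    have h4 : Real.exp (-(q / ((d : ℝ) + 1) ^ (4 * s)))
        = Real.exp (-(1 / ((d : ℝ) + 1) ^ (4 * s))) ^ q := by
      rw [← Real.exp_nat_mul]
      congr 1
      ring
    rw [h4, ← mul_pow]
    refine pow_le_pow_left₀ (by linarith) ?_ q
    calc c ^ (4 * s) - 1 = (1 - 1 / c ^ (4 * s)) * c ^ (4 * s) := by field_simp
      _ ≤ _ := mul_le_mul_of_nonneg_right h1 (by linarith)
  rw [hsq] at hlow
  rw [show 2 * (2 * s) = 4 * s by ring] at hfrob
  refine le_of_mul_le_mul_right ?_ (show 0 < (c ^ (4 * s)) ^ q by positivity)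
  calc _ ≤ _ := hlow
    _ ≤ _ := hfrob
    _ ≤ Fintype.card V * (Real.exp (-(q / (d + 1) ^ (4 * s))) * (c ^ (4 * s)) ^ q) :=
      mul_le_mul_of_nonneg_left hexp (Nat.cast_nonneg _)
    _ = _ := by ring

end SimpleGraph

lemma succ_mul_pow_le_exp_exp {D s : ℕ} (hD : 1 ≤ D) (hs : s ≠ 0) :
    ((s : ℝ) + 1) * (D : ℝ) ^ (2 * (2 * s * (s * D ^ (4 * s))) + 1) ≤
      Real.exp (Real.exp ((5 * Real.log D + 5) * s)) := by
  have hD1 : (1 : ℝ) ≤ D := by exact_mod_cast hD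
  have hs1 : (1 : ℝ) ≤ s := by exact_mod_cast Nat.one_le_iff_ne_zero.2 hs
  have hK : Real.exp ((5 * Real.log D + 5) * s) = (D : ℝ) ^ (5 * s) * Real.exp s ^ 5 := by
    rw [show (5 * Real.log D + 5) * s = ((5 * s : ℕ) : ℝ) * Real.log D + ((5 : ℕ) : ℝ) * s by
      push_cast; ring, Real.exp_add, Real.exp_nat_mul, Real.exp_nat_mul,
      Real.exp_log (by linarith)]
  have hDexp : (D : ℝ) ≤ Real.exp D := by linarith [Real.add_one_le_exp (D : ℝ)]
  have hs_exp := Real.add_one_le_exp (s : ℝ)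
  have h5 : ((s : ℝ) + 1) ^ 5 ≤ Real.exp s ^ 5 := pow_le_pow_left₀ (by positivity) hs_exp 5
  have hpow : (D : ℝ) ^ (4 * s) * D ≤ (D : ℝ) ^ (5 * s) := by
    rw [← pow_succ]
    exact pow_le_pow_right₀ hD1 (by omega)
  have hone : (1 : ℝ) ≤ (D : ℝ) ^ (5 * s) := one_le_pow₀ hD1
  have hDle : (D : ℝ) ≤ (D : ℝ) ^ (5 * s) := le_self_pow₀ hD1 (by omega)
  calc ((s : ℝ) + 1) * (D : ℝ) ^ (2 * (2 * s * (s * D ^ (4 * s))) + 1)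
      ≤ Real.exp s * Real.exp D ^ (2 * (2 * s * (s * D ^ (4 * s))) + 1) := by gcongr
    _ = Real.exp (s + (4 * s ^ 2 * ((D : ℝ) ^ (4 * s) * D) + D)) := by
      rw [← Real.exp_nat_mul, ← Real.exp_add]
      congr 1
      push_cast
      ring
    _ ≤ Real.exp (Real.exp ((5 * Real.log D + 5) * s)) := by
      rw [Real.exp_le_exp, hK]
      calc (s : ℝ) + (4 * s ^ 2 * ((D : ℝ) ^ (4 * s) * D) + D)
          ≤ s * (D : ℝ) ^ (5 * s) + (4 * s ^ 2 * (D : ℝ) ^ (5 * s) + (D : ℝ) ^ (5 * s)) := by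
            gcongr
            exact le_mul_of_one_le_right (by linarith) hone
        _ = (D : ℝ) ^ (5 * s) * (s + 4 * s ^ 2 + 1) := by ring
        _ ≤ (D : ℝ) ^ (5 * s) * Real.exp s ^ 5 := by
            refine mul_le_mul_of_nonneg_left (le_trans ?_ h5) (by positivity)
            have h3 : (0 : ℝ) ≤ (s : ℝ) ^ 3 := by positivity
            have h4 : (0 : ℝ) ≤ (s : ℝ) ^ 4 := by positivity
            have h6 : (0 : ℝ) ≤ (s : ℝ) ^ 5 := by positivity
            nlinarith

/-- Jiang–Tidor–Yao–Zhang–Zhao: for every `j ≥ 1` and `d ≥ 1` there is `C > 0` such that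
for every connected simple graph `G` on `n ≥ 3` vertices with maximum degree at most `d`,
the multiplicity of the `j`-th largest eigenvalue of the adjacency matrix of `G` is at most
`C * n / log log n`. The eigenvalues `λ 0 ≥ λ 1 ≥ ⋯ ≥ λ (n-1)` are listed in decreasing
order with multiplicity, encoded by `λ` being antitone and the characteristic polynomial of
the adjacency matrix being `∏ i, (X - λ i)`; the `j`-th largest eigenvalue is `λ (j-1)`. -/
theorem adjacency_multiplicity_sublinear
    (j d : ℕ) (hj : 1 ≤ j) (hd : 1 ≤ d) :
    ∃ C : ℝ, 0 < C ∧
      ∀ (n : ℕ), 3 ≤ n →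
        ∀ (G : SimpleGraph (Fin n)) [DecidableRel G.Adj],
          G.Connected →
          (∀ v : Fin n, G.degree v ≤ d) →
          ∀ lam : Fin n → ℝ, Antitone lam →
            (G.adjMatrix ℝ).charpoly = ∏ i : Fin n, (X - Polynomial.C (lam i)) →
            ∀ hjn : j ≤ n,
              ((Finset.univ.filter
                  (fun i : Fin n => lam i = lam ⟨j - 1, by omega⟩)).card : ℝ)
                ≤ C * n / Real.log (Real.log n) := by
  classical
  have hD : (1 : ℝ) ≤ ((d + 1 : ℕ) : ℝ) := by exact_mod_cast Nat.succ_pos d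
  set K : ℝ := 5 * Real.log ((d + 1 : ℕ) : ℝ) + 5 with hK
  have hKpos : 0 < K := by
    have := Real.log_nonneg hD
    positivity
  refine ⟨(j + 2) * K, by positivity, ?_⟩
  intro n hn G _ hG hdeg lam hanti hchar hjn
  have hn3 : (3 : ℝ) ≤ n := by exact_mod_cast hn
  have hlog : 1 < Real.log n := by
    rw [Real.lt_log_iff_exp_lt (by linarith)]
    linarith [Real.exp_one_lt_d9]
  set L := Real.log (Real.log n) with hL
  have hLpos : 0 < L := Real.log_pos hlog
  set c := lam ⟨j - 1, by omega⟩ with hc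
  have hm_le : ((Finset.univ.filter fun i : Fin n => lam i = c).card : ℝ) ≤ n := by
    have := Finset.card_le_univ (Finset.univ.filter fun i : Fin n => lam i = c)
    rw [Fintype.card_fin] at this
    exact_mod_cast this
  rw [le_div_iff₀ hLpos]
  set s := ⌊L / K⌋₊ with hs
  have hLs : L < (s + 1) * K := (div_lt_iff₀ hKpos).1 (Nat.lt_floor_add_one _)
  by_cases hs0 : s = 0
  · rw [hs0, Nat.cast_zero, zero_add, one_mul] at hLs
    calc _ ≤ (n : ℝ) * K := mul_le_mul hm_le hLs.le hLpos.le (by positivity)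
      _ ≤ (j + 2) * K * n := by
        have : (0 : ℝ) ≤ (j + 1) * (K * n) := by positivity
        linarith
  have hKs : K * s ≤ L := by
    rw [mul_comm, ← le_div_iff₀ hKpos]
    exact Nat.floor_le (by positivity)
  have hexp : Real.exp (Real.exp (K * s)) ≤ n := by
    rw [← Real.le_log_iff_exp_le (by linarith), ← Real.le_log_iff_exp_le (by linarith)]
    exact hKs
  have hball := (succ_mul_pow_le_exp_exp (Nat.succ_pos d) hs0).trans hexp
  set q := s * (d + 1) ^ (4 * s) with hq
  have hq0 : q ≠ 0 := by positivity
  have hsn : s < Fintype.card (Fin n) := by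
    rw [Fintype.card_fin]
    have h1 : ((s : ℝ) + 1) * 1 ≤ n :=
      (mul_le_mul_of_nonneg_left (one_le_pow₀ hD) (by positivity)).trans hball
    have h2 : s + 1 ≤ n := by exact_mod_cast (mul_one ((s : ℝ) + 1)) ▸ h1
    exact h2
  obtain ⟨b, hb⟩ := (G.isSymm_adjMatrix (α := ℝ)).exists_orthonormalBasis_of_charpoly_eq hchar
  have : Nontrivial (Fin n) := Fin.nontrivial_iff_two_le.2 (by omega)
  have hmain := hG.card_eigenvalue_eq_le hdeg hb c hs0 hq0 hsn
  have hfew : ((Finset.univ.filter fun i => c < lam i).card : ℝ) ≤ j := by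
    have hsub : (Finset.univ.filter fun i => c < lam i) ⊆ Finset.Iio ⟨j - 1, by omega⟩ :=
      fun i hi => by
        rw [Finset.mem_Iio]
        by_contra! hcon
        exact (Finset.mem_filter.1 hi).2.not_ge (hanti hcon)
    have := Finset.card_le_card hsub
    rw [Fin.card_Iio] at this
    exact_mod_cast this.trans (Nat.sub_le j 1)
  have hqdiv : (q : ℝ) / (d + 1) ^ (4 * s) = s := by
    rw [hq]
    push_cast
    field_simp
  have hexps : Real.exp (-s) ≤ 1 / (s + 1) := by
    rw [Real.exp_neg, ← one_div]
    exact one_div_le_one_div_of_le (by positivity) (Real.add_one_le_exp _)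
  rw [hqdiv, Fintype.card_fin] at hmain
  have hpow : ((d : ℝ) + 1) ^ (2 * (2 * s * q) + 1) ≤ n / (s + 1) := by
    rw [le_div_iff₀ (by positivity), mul_comm]
    exact_mod_cast hball
  have hm : ((Finset.univ.filter fun i : Fin n => lam i = c).card : ℝ)
      ≤ (j + 2) * (n / (s + 1)) := by
    calc _ ≤ _ := hmain
      _ ≤ n / (s + 1) + j * (n / (s + 1)) + n * (1 / (s + 1)) := by gcongr
      _ = _ := by ring
  calc _ ≤ (j + 2) * (n / (s + 1)) * ((s + 1) * K) :=
        mul_le_mul hm hLs.le hLpos.le (by positivity)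
    _ = (j + 2) * K * n := by field_simp
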